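/- Let 𝓐 be the measure acceptance set of a law invariant risk measure. Then 𝓐 is shift-convex if and only if it satisfies the following property (S): for each M > 0 and each Borel probability measure γ on ℝ × (𝓐 ∩ 𝓟[-M,M]) whose first marginal belongs to 𝓐, the measure ∫ γ(dx,dm) m(· − x) belongs to 𝓐. -/

import Mathlib

open MeasureTheory ProbabilityTheory Filter Topology
open scoped ENNReal NNReal

noncomputable section

namespace RiskDiv

/-- A bounded measurable real-valued function (a representative of an element of `L^∞`). -/
def BddMeas {E : Type*} [MeasurableSpace E] (f : E → ℝ) : Prop :=
  Measurable f ∧ ∃ M : ℝ, ∀ x, |f x| ≤ M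

/-- A (normalized, convex, monotone, cash-additive) risk measure on `L^∞(E, μ)`,
viewed as a functional on bounded measurable functions which respects a.e. equality. -/
structure IsRiskMeasure {E : Type*} [MeasurableSpace E] (μ : Measure E)
    (ρ : (E → ℝ) → ℝ) : Prop where
  mono : ∀ f g : E → ℝ, BddMeas f → BddMeas g → (∀ᵐ x ∂μ, f x ≤ g x) → ρ f ≤ ρ g
  cash : ∀ (f : E → ℝ) (c : ℝ), BddMeas f → ρ (fun x => f x + c) = ρ f + c
  norm0 : ρ (fun _ => 0) = 0
  cvx : ∀ (f g : E → ℝ) (t : ℝ), BddMeas f → BddMeas g → 0 ≤ t → t ≤ 1 →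
    ρ (fun x => t * f x + (1 - t) * g x) ≤ t * ρ f + (1 - t) * ρ g
  congr_ae : ∀ f g : E → ℝ, BddMeas f → BddMeas g → (∀ᵐ x ∂μ, f x = g x) → ρ f = ρ g

/-- Law invariance: `ρ` only depends on the distribution of its argument. -/
def LawInvariant {E : Type*} [MeasurableSpace E] (μ : Measure E) (ρ : (E → ℝ) → ℝ) : Prop :=
  ∀ f g : E → ℝ, BddMeas f → BddMeas g → μ.map f = μ.map g → ρ f = ρ g

open Classical in
/-- `ρ_μ(f) := ρ(f ∘ X)` where `X` is any random variable with law `μ` (this is well defined,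
independently of the choice of `X`, when `ρ` is law invariant). -/
def rhoMu {Ω : Type*} [MeasurableSpace Ω] (P : Measure Ω) (ρ : (Ω → ℝ) → ℝ)
    {E : Type*} [MeasurableSpace E] (μ : Measure E) (f : E → ℝ) : ℝ :=
  if h : ∃ X : Ω → E, Measurable X ∧ P.map X = μ then ρ (f ∘ h.choose) else 0

/-- The divergence induced by `ρ`:
`α(ν|μ) := sup { ∫ f dν − ρ_μ(f) : f bounded measurable } ∈ [0,∞]`. -/
def divergence {Ω : Type*} [MeasurableSpace Ω] (P : Measure Ω) (ρ : (Ω → ℝ) → ℝ)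
    {E : Type*} [MeasurableSpace E] (ν μ : Measure E) : ℝ≥0∞ :=
  ⨆ (f : E → ℝ) (_ : BddMeas f), ENNReal.ofReal ((∫ x, f x ∂ν) - rhoMu P ρ μ f)

/-- The divergence induced by `ρ` is simplified if, on `[0,1]`, the supremum defining it can be
restricted to continuous functions. -/
def Simplified {Ω : Type*} [MeasurableSpace Ω] (P : Measure Ω) (ρ : (Ω → ℝ) → ℝ) : Prop :=
  ∀ μ ν : Measure (Set.Icc (0:ℝ) 1), IsProbabilityMeasure μ → IsProbabilityMeasure ν →
    divergence P ρ ν μ =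
      ⨆ (f : (Set.Icc (0:ℝ) 1) → ℝ) (_ : Continuous f),
        ENNReal.ofReal ((∫ x, f x ∂ν) - rhoMu P ρ μ f)

/-- `ρ̃`, the map on distributions induced by a law invariant risk measure:
`ρ̃(P ∘ Z⁻¹) = ρ(Z)`. -/
def tildeRho {Ω : Type*} [MeasurableSpace Ω] (P : Measure Ω) (ρ : (Ω → ℝ) → ℝ)
    (m : Measure ℝ) : ℝ :=
  rhoMu P ρ m id

/-- The conditional risk `ρ(X | 𝓖)(ω) := ρ̃(P(X ∈ · | 𝓖)(ω))`, defined through a regular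
conditional law of `X` given the sub-σ-field `G`. -/
def condRho {Ω : Type*} [mΩ : MeasurableSpace Ω] [sb : StandardBorelSpace Ω]
    (P : Measure Ω) [fin : IsFiniteMeasure P] (ρ : (Ω → ℝ) → ℝ)
    (G : MeasurableSpace Ω) (X : Ω → ℝ) (ω : Ω) : ℝ :=
  @tildeRho Ω mΩ P ρ (@Measure.map Ω ℝ mΩ _ X (@condExpKernel Ω mΩ sb P fin G ω))

/-- `ρ` is acceptance consistent if `ρ(X) ≤ ρ(ρ(X|𝓖))` for all `X ∈ L^∞` and sub-σ-fields `𝓖`. -/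
def AcceptanceConsistent {Ω : Type*} [mΩ : MeasurableSpace Ω] [sb : StandardBorelSpace Ω]
    (P : Measure Ω) [fin : IsFiniteMeasure P] (ρ : (Ω → ℝ) → ℝ) : Prop :=
  ∀ X : Ω → ℝ, BddMeas X → ∀ G : MeasurableSpace Ω, G ≤ mΩ →
    ρ X ≤ ρ (@condRho Ω mΩ sb P fin ρ G X)

/-- `ρ` is rejection consistent if `ρ(X) ≥ ρ(ρ(X|𝓖))` for all `X ∈ L^∞` and sub-σ-fields `𝓖`. -/
def RejectionConsistent {Ω : Type*} [mΩ : MeasurableSpace Ω] [sb : StandardBorelSpace Ω]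
    (P : Measure Ω) [fin : IsFiniteMeasure P] (ρ : (Ω → ℝ) → ℝ) : Prop :=
  ∀ X : Ω → ℝ, BddMeas X → ∀ G : MeasurableSpace Ω, G ≤ mΩ →
    ρ (@condRho Ω mΩ sb P fin ρ G X) ≤ ρ X

/-- `ρ` is weakly acceptance consistent if `ρ(X|𝓖) ≤ 0` a.s. implies `ρ(X) ≤ 0`. -/
def WeaklyAcceptanceConsistent {Ω : Type*} [mΩ : MeasurableSpace Ω] [sb : StandardBorelSpace Ω]
    (P : Measure Ω) [fin : IsFiniteMeasure P] (ρ : (Ω → ℝ) → ℝ) : Prop :=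
  ∀ X : Ω → ℝ, BddMeas X → ∀ G : MeasurableSpace Ω, G ≤ mΩ →
    (∀ᵐ ω ∂P, @condRho Ω mΩ sb P fin ρ G X ω ≤ 0) → ρ X ≤ 0

/-- The measure acceptance set `𝓐 = {P ∘ X⁻¹ : X ∈ L^∞, ρ(X) ≤ 0} ⊆ 𝓟(ℝ)`. -/
def acceptanceSet {Ω : Type*} [MeasurableSpace Ω] (P : Measure Ω) (ρ : (Ω → ℝ) → ℝ) :
    Set (Measure ℝ) :=
  {m | ∃ X : Ω → ℝ, BddMeas X ∧ ρ X ≤ 0 ∧ P.map X = m}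

/-- A set `A ⊆ 𝓟(ℝ)` is shift-convex if for every `μ ∈ A`, every `M > 0` and every measurable
map `x ↦ K x ∈ A ∩ 𝓟[-M,M]`, the measure `∫ μ(dx) K_x(· − x)` belongs to `A`. -/
def ShiftConvex (A : Set (Measure ℝ)) : Prop :=
  ∀ μ ∈ A, ∀ M : ℝ, 0 < M → ∀ K : ℝ → Measure ℝ, Measurable K →
    (∀ x : ℝ, K x ∈ A ∧ (K x) (Set.Icc (-M) M)ᶜ = 0) →
    μ.bind (fun x => (K x).map (fun y => y + x)) ∈ A

/-- existence of a uniform variable -/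
lemma exists_uniform {Ω : Type*} [MeasurableSpace Ω] [StandardBorelSpace Ω]
    (P : Measure Ω) [IsProbabilityMeasure P] [NullSingletonClass P] :
    ∃ U : Ω → unitInterval, Measurable U ∧ P.map U = volume := by
  have hne : Nonempty Ω := nonempty_of_isProbabilityMeasure P
  have he := measurableEmbedding_embeddingReal Ω
  set e := embeddingReal Ω
  set p := P.map e with hp
  have : IsProbabilityMeasure p := Measure.isProbabilityMeasure_map he.measurable.aemeasurable
  have hcont : Continuous (cdf p) := by
    rw [continuous_iff_continuousAt]
    intro x
    have h0 : p {x} = 0 := by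
      rw [hp, Measure.map_apply he.measurable (measurableSet_singleton x)]
      exact (Set.subsingleton_singleton.preimage he.injective).measure_zero P
    rw [← measure_cdf p, StieltjesFunction.measure_singleton, ENNReal.ofReal_eq_zero] at h0
    have h1 : Function.leftLim (cdf p) x = cdf p x :=
      le_antisymm ((cdf p).mono.leftLim_le le_rfl) (by linarith)
    rw [(cdf p).mono.continuousAt_iff_leftLim_eq_rightLim, h1, StieltjesFunction.rightLim_eq]
  have hsurj : ∀ v : ℝ, 0 < v → v < 1 → ∃ y, cdf p y = v := by
    intro v h0 h1
    have a := ((tendsto_cdf_atBot p).eventually (gt_mem_nhds h0)).exists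
    have b := ((tendsto_cdf_atTop p).eventually (lt_mem_nhds h1)).exists
    exact mem_range_of_exists_le_of_exists_ge hcont ⟨_, a.choose_spec.le⟩ ⟨_, b.choose_spec.le⟩
  have hval : ∀ y, P.real {ω | e ω ≤ y} = cdf p y := by
    intro y
    rw [cdf_eq_real, hp, map_measureReal_apply he.measurable measurableSet_Iic]
    rfl
  let U : Ω → unitInterval := fun ω => ⟨cdf p (e ω), cdf_nonneg p _, cdf_le_one p _⟩
  have hU : Measurable U :=
    ((cdf p).mono.measurable.comp he.measurable).subtype_mk
  refine ⟨U, hU, ?_⟩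
  have := Measure.isProbabilityMeasure_map (μ := P) hU.aemeasurable
  refine Measure.ext_of_Iic _ _ fun u => ?_
  rw [Measure.map_apply hU measurableSet_Iic, unitInterval.volume_Iic, ← ofReal_measureReal]
  congr 1
  apply le_antisymm
  · by_contra! h
    obtain ⟨v, hv1, hv2⟩ := exists_between h
    obtain ⟨y, hy⟩ := hsurj v (u.2.1.trans_lt hv1) (hv2.trans_le measureReal_le_one)
    rw [← hy, ← hval] at hv2
    refine hv2.not_ge (measureReal_mono ?_)
    intro ω hω
    by_contra! hc
    have h3 : cdf p (e ω) ≤ u := hω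
    have h4 : y < e ω := not_le.mp hc
    have := (cdf p).mono h4.le
    linarith
  · by_contra! h
    obtain ⟨v, hv1, hv2⟩ := exists_between h
    obtain ⟨y, hy⟩ := hsurj v (measureReal_nonneg.trans_lt hv1) (hv2.trans_le u.2.2)
    rw [← hy, ← hval] at hv1
    refine hv1.not_ge (measureReal_mono ?_)
    intro ω hω
    have h4 : e ω ≤ y := hω
    have := (cdf p).mono h4
    change cdf p (e ω) ≤ u
    linarith

lemma exists_law {Ω : Type*} [MeasurableSpace Ω] [StandardBorelSpace Ω]
    (P : Measure Ω) [IsProbabilityMeasure P] [NullSingletonClass P]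
    {Y : Type*} [MeasurableSpace Y] [StandardBorelSpace Y] (ν : Measure Y)
    [IsProbabilityMeasure ν] : ∃ Z : Ω → Y, Measurable Z ∧ P.map Z = ν := by
  have : Nonempty Y := nonempty_of_isProbabilityMeasure ν
  obtain ⟨U, hU, hUm⟩ := exists_uniform P
  obtain ⟨f, hf, hfm⟩ := ν.exists_measurable_map_eq
  exact ⟨f ∘ U, hf.comp hU, by rw [← Measure.map_map hf hU, hUm, hfm]⟩

/-- quantile coupling -/
lemma exists_coupling {Ω : Type*} [MeasurableSpace Ω] [StandardBorelSpace Ω]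
    (P : Measure Ω) [IsProbabilityMeasure P] [NullSingletonClass P]
    (μ ν : Measure ℝ) [IsProbabilityMeasure μ] [IsProbabilityMeasure ν] (B : ℝ)
    (hμ : μ (Set.Icc (-B) B)ᶜ = 0) (hν : ν (Set.Icc (-B) B)ᶜ = 0)
    (h : ∀ t, μ (Set.Ici t) ≤ ν (Set.Ici t)) :
    ∃ X Y : Ω → ℝ, BddMeas X ∧ BddMeas Y ∧ P.map X = μ ∧ P.map Y = ν ∧ ∀ ω, X ω ≤ Y ω := by
  obtain ⟨U, hU, hUm⟩ := exists_uniform P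
  -- quantile
  have key : ∀ (m : Measure ℝ) [IsProbabilityMeasure m], m (Set.Icc (-B) B)ᶜ = 0 →
      let q : ℝ → ℝ := fun u => sInf {x | -B ≤ x ∧ u ≤ cdf m x}
      (∀ u, u ≤ 1 → ∀ x, -B ≤ x → (q u ≤ x ↔ u ≤ cdf m x)) ∧
      (∀ u, u ≤ 1 → -B ≤ q u ∧ q u ≤ B) ∧ Measurable (fun ω => q (U ω)) ∧
      P.map (fun ω => q (U ω)) = m := by
    intro m _ hm q
    have hB : -B ≤ B := by
      by_contra! hc
      rw [Set.Icc_eq_empty (not_le.mpr hc)] at hm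
      simp at hm
    have hB1 : cdf m B = 1 := by
      rw [cdf_eq_real, measureReal_def, (prob_compl_eq_zero_iff measurableSet_Iic).mp, ENNReal.toReal_one]
      exact measure_mono_null (Set.compl_subset_compl.mpr fun x hx => hx.2) hm
    have hB0 : ∀ x, x < -B → cdf m x = 0 := by
      intro x hx
      rw [cdf_eq_real, measureReal_def, measure_mono_null _ hm, ENNReal.toReal_zero]
      intro y hy hy'
      exact absurd (hy'.1.trans hy) (not_le.mpr hx)
    have hne : ∀ u, u ≤ 1 → B ∈ {x | -B ≤ x ∧ u ≤ cdf m x} := fun u hu => ⟨hB, hu.trans hB1.ge⟩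
    have hbb : ∀ u, BddBelow {x | -B ≤ x ∧ u ≤ cdf m x} := fun u => ⟨-B, fun x hx => hx.1⟩
    have hiff : ∀ u, u ≤ 1 → ∀ x, -B ≤ x → (q u ≤ x ↔ u ≤ cdf m x) := by
      intro u hu x hx
      constructor
      · intro hq
        by_contra! hc
        have : ∀ᶠ y in 𝓝[≥] x, cdf m y < u :=
          ((cdf m).right_continuous x).eventually (gt_mem_nhds hc)
        have := this.filter_mono (nhdsWithin_mono _ Set.Ioi_subset_Ici_self)
        obtain ⟨y, hy1, hy2⟩ := (this.and self_mem_nhdsWithin).exists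
        have h5 : y ≤ q u := le_csInf ⟨_, hne u hu⟩ fun z hz => by
          by_contra! hzy
          have := (cdf m).mono hzy.le
          have := hz.2
          linarith
        have : x < y := hy2
        linarith
      · intro h
        exact csInf_le (hbb u) ⟨hx, h⟩
    have hbd : ∀ u, u ≤ 1 → -B ≤ q u ∧ q u ≤ B := fun u hu =>
      ⟨le_csInf ⟨_, hne u hu⟩ fun z hz => hz.1, csInf_le (hbb u) (hne u hu)⟩
    have hpre : ∀ x, -B ≤ x → (fun ω => q (U ω)) ⁻¹' Set.Iic x =
        U ⁻¹' Set.Iic ⟨cdf m x, cdf_nonneg m x, cdf_le_one m x⟩ := by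
      intro x hx
      ext ω
      exact hiff _ (U ω).2.2 x hx
    have hpre' : ∀ x, x < -B → (fun ω => q (U ω)) ⁻¹' Set.Iic x = ∅ := by
      intro x hx
      ext ω
      have := (hbd _ (U ω).2.2).1
      simp only [Set.mem_preimage, Set.mem_Iic, Set.mem_empty_iff_false, iff_false, not_le]
      linarith
    have hmeas : Measurable (fun ω => q (U ω)) := by
      refine measurable_of_Iic fun x => ?_
      rcases le_or_gt (-B) x with hx | hx
      · rw [hpre x hx]; exact hU measurableSet_Iic
      · rw [hpre' x hx]; exact MeasurableSet.empty
    refine ⟨hiff, hbd, hmeas, ?_⟩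
    have := Measure.isProbabilityMeasure_map (μ := P) hmeas.aemeasurable
    refine Measure.ext_of_Iic _ _ fun x => ?_
    rw [Measure.map_apply hmeas measurableSet_Iic]
    rcases le_or_gt (-B) x with hx | hx
    · rw [hpre x hx, ← Measure.map_apply hU measurableSet_Iic, hUm, unitInterval.volume_Iic,
        ofReal_cdf]
    · rw [hpre' x hx, ← ofReal_cdf, hB0 x hx]; simp
  obtain ⟨i1, b1, m1, l1⟩ := key μ hμ
  obtain ⟨i2, b2, m2, l2⟩ := key ν hν
  have hcdf : ∀ x, cdf ν x ≤ cdf μ x := by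
    intro x
    have hIoi : μ (Set.Ioi x) ≤ ν (Set.Ioi x) := by
      have hU : Set.Ioi x = ⋃ n : ℕ, Set.Ici (x + 1 / ((n:ℝ) + 1)) := by
        ext y
        simp only [Set.mem_Ioi, Set.mem_iUnion, Set.mem_Ici]
        constructor
        · intro hy
          obtain ⟨n, hn⟩ := exists_nat_one_div_lt (sub_pos.mpr hy)
          exact ⟨n, by linarith⟩
        · rintro ⟨n, hn⟩
          have : (0:ℝ) < 1 / ((n:ℝ) + 1) := by positivity
          linarith
      have hmono : Monotone (fun n : ℕ => Set.Ici (x + 1 / ((n:ℝ) + 1))) := by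
        intro a b hab
        apply Set.Ici_subset_Ici.mpr
        have := Nat.one_div_le_one_div (α := ℝ) hab
        linarith
      rw [hU, hmono.measure_iUnion, hmono.measure_iUnion]
      exact iSup_mono fun n => h _
    have e : ∀ (m : Measure ℝ) [IsProbabilityMeasure m], m.real (Set.Ioi x) = 1 - cdf m x := by
      intro m _
      rw [← Set.compl_Iic, probReal_compl_eq_one_sub measurableSet_Iic, cdf_eq_real]
    have : μ.real (Set.Ioi x) ≤ ν.real (Set.Ioi x) :=
      ENNReal.toReal_mono (measure_ne_top _ _) hIoi
    rw [e, e] at this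
    linarith
  refine ⟨_, _, ⟨m1, B, fun ω => ?_⟩, ⟨m2, B, fun ω => ?_⟩, l1, l2, fun ω => ?_⟩
  · exact abs_le.mpr (b1 _ (U ω).2.2)
  · exact abs_le.mpr (b2 _ (U ω).2.2)
  · refine (i1 _ (U ω).2.2 _ (b2 _ (U ω).2.2).1).mpr (le_trans ?_ (hcdf _))
    exact (i2 _ (U ω).2.2 _ (b2 _ (U ω).2.2).1).mp le_rfl

lemma mem_bdd {Ω : Type*} [MeasurableSpace Ω] (P : Measure Ω) [IsProbabilityMeasure P]
    {ρ : (Ω → ℝ) → ℝ} {ν : Measure ℝ} (h : ν ∈ acceptanceSet P ρ) :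
    IsProbabilityMeasure ν ∧ ∃ B : ℝ, 0 ≤ B ∧ ν (Set.Icc (-B) B)ᶜ = 0 := by
  obtain ⟨X, ⟨hX, B, hB⟩, -, rfl⟩ := h
  refine ⟨Measure.isProbabilityMeasure_map hX.aemeasurable, B, ?_, ?_⟩
  · obtain ⟨ω⟩ := nonempty_of_isProbabilityMeasure P
    exact (abs_nonneg _).trans (hB ω)
  · rw [Measure.map_apply hX measurableSet_Icc.compl]
    convert measure_empty (μ := P)
    ext ω
    simpa using abs_le.mp (hB ω)

lemma supp_mono {ν : Measure ℝ} {B B' : ℝ} (h : B ≤ B') (hν : ν (Set.Icc (-B) B)ᶜ = 0) :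
    ν (Set.Icc (-B') B')ᶜ = 0 :=
  measure_mono_null (Set.compl_subset_compl.mpr (Set.Icc_subset_Icc (by linarith) h)) hν

lemma rho_of_law_mem {Ω : Type*} [MeasurableSpace Ω] {P : Measure Ω}
    {ρ : (Ω → ℝ) → ℝ} (hLI : LawInvariant P ρ) {X : Ω → ℝ} (hX : BddMeas X)
    (h : P.map X ∈ acceptanceSet P ρ) : ρ X ≤ 0 := by
  obtain ⟨Y, hY, hY0, hYX⟩ := h
  rwa [hLI X Y hX hY hYX.symm]

lemma dom {Ω : Type*} [MeasurableSpace Ω] [StandardBorelSpace Ω]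
    (P : Measure Ω) [IsProbabilityMeasure P] [NullSingletonClass P]
    {ρ : (Ω → ℝ) → ℝ} (hρ : IsRiskMeasure P ρ) (hLI : LawInvariant P ρ)
    {μ ν : Measure ℝ} (hμ : IsProbabilityMeasure μ) (B : ℝ) (hB : μ (Set.Icc (-B) B)ᶜ = 0)
    (hν : ν ∈ acceptanceSet P ρ) (h : ∀ t, μ (Set.Ici t) ≤ ν (Set.Ici t)) :
    μ ∈ acceptanceSet P ρ := by
  obtain ⟨hp, B', -, hB'⟩ := mem_bdd P hν
  obtain ⟨X, Y, hX, hY, hXm, hYm, hXY⟩ := exists_coupling P μ ν (max B B')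
    (supp_mono (le_max_left _ _) hB) (supp_mono (le_max_right _ _) hB') h
  refine ⟨X, hX, ?_, hXm⟩
  exact (hρ.mono X Y hX hY (ae_of_all _ hXY)).trans (rho_of_law_mem hLI hY (hYm ▸ hν))

lemma bdd_clip {E : Type*} [MeasurableSpace E] {f : E → ℝ} (hf : Measurable f) {C : ℝ}
    (hC : 0 ≤ C) : BddMeas (fun x => max (-C) (min C (f x))) :=
  ⟨by fun_prop, C, fun x => abs_le.mpr ⟨le_max_left _ _, max_le (by linarith) (min_le_left _ _)⟩⟩

lemma rho_avg {Ω : Type*} [MeasurableSpace Ω] {P : Measure Ω}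
    {ρ : (Ω → ℝ) → ℝ} (hρ : IsRiskMeasure P ρ) (Z : ℕ → Ω → ℝ) (K : ℝ) (hZm : ∀ j, Measurable (Z j))
    (hZ : ∀ j ω, |Z j ω| ≤ K) (n : ℕ) (h0 : ∀ j, j < n + 1 → ρ (Z j) ≤ 0) :
    BddMeas (fun ω => ((n:ℝ) + 1)⁻¹ * ∑ j ∈ Finset.range (n + 1), Z j ω) ∧
    ρ (fun ω => ((n:ℝ) + 1)⁻¹ * ∑ j ∈ Finset.range (n + 1), Z j ω) ≤ 0 := by
  have hb : ∀ n : ℕ, BddMeas (fun ω => ((n:ℝ) + 1)⁻¹ * ∑ j ∈ Finset.range (n + 1), Z j ω) := by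
    intro n
    refine ⟨by fun_prop, K, fun ω => ?_⟩
    rw [abs_mul, abs_of_nonneg (by positivity : (0:ℝ) ≤ ((n:ℝ) + 1)⁻¹),
      inv_mul_le_iff₀ (by positivity)]
    refine (Finset.abs_sum_le_sum_abs _ _).trans ((Finset.sum_le_sum fun j _ => hZ j ω).trans ?_)
    simp
  refine ⟨hb n, ?_⟩
  induction n with
  | zero => simpa using h0 0
  | succ n ih =>
    have ih := ih fun j hj => h0 j (by omega)
    have hn : (0:ℝ) < (n:ℝ) + 1 := by positivity
    have hn2 : (0:ℝ) < (n:ℝ) + 2 := by positivity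
    have := hρ.cvx _ (Z (n+1)) (((n:ℝ) + 1) / (n + 2)) (hb n) ⟨hZm _, K, hZ _⟩ (by positivity)
      (by rw [div_le_one hn2]; linarith)
    have h1 := h0 (n+1) (by omega)
    have e : (fun ω => (((n + 1 : ℕ) : ℝ) + 1)⁻¹ * ∑ j ∈ Finset.range (n + 1 + 1), Z j ω) =
      fun x => (((n:ℝ) + 1) / (n + 2)) * (((n:ℝ) + 1)⁻¹ * ∑ j ∈ Finset.range (n + 1), Z j x)
        + (1 - ((n:ℝ) + 1) / (n + 2)) * Z (n+1) x := by
      funext x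
      rw [Finset.sum_range_succ _ (n+1)]
      push_cast
      have : (n:ℝ) + 1 + 1 = n + 2 := by ring
      rw [this]
      field_simp
      ring
    rw [e]
    refine this.trans ?_
    have h2 : 0 ≤ 1 - ((n:ℝ) + 1) / (n + 2) := by
      rw [sub_nonneg, div_le_one hn2]; linarith
    have h3 : 0 ≤ ((n:ℝ) + 1) / (n + 2) := by positivity
    nlinarith [mul_nonneg h3 (neg_nonneg.mpr ih), mul_nonneg h2 (neg_nonneg.mpr h1)]

lemma mem_of_approx {Ω : Type*} [MeasurableSpace Ω] [StandardBorelSpace Ω]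
    (P : Measure Ω) [IsProbabilityMeasure P] [NullSingletonClass P]
    {ρ : (Ω → ℝ) → ℝ} (hρ : IsRiskMeasure P ρ) (hLI : LawInvariant P ρ)
    {ν : Measure ℝ} (hν : IsProbabilityMeasure ν) (C C' : ℝ) (hC : 0 ≤ C) (hC' : 0 ≤ C')
    (hB : ν (Set.Icc (-C) C)ᶜ = 0)
    (h : ∀ n : ℕ, ∀ ε : ℝ, 0 < ε → ε ≤ 1 → ∃ ν₁ ∈ acceptanceSet P ρ,
      (∀ t, (1 - ((n + 1 : ℕ) : ℝ≥0∞)⁻¹) * ν (Set.Ici (t + 3 * ε)) ≤ ν₁ (Set.Ici t)) ∧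
      ∀ t ≤ -C', ν₁ (Set.Ici t) = 1) : ν ∈ acceptanceSet P ρ := by
  have hae : ∀ᵐ x ∂ν, x ∈ Set.Icc (-C) C := hB
  have clipmap : ∀ Z : Ω → ℝ, Measurable Z → P.map Z = ν →
      ∀ᵐ ω ∂P, max (-C) (min C (Z ω)) = Z ω := by
    intro Z hZ hZm
    rw [← hZm] at hae
    filter_upwards [ae_of_ae_map hZ.aemeasurable hae] with ω hω
    rw [min_eq_right hω.2, max_eq_right hω.1]
  obtain ⟨X, hX, hXm⟩ := exists_law P ν
  have hXc := bdd_clip hX hC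
  have hXcm : P.map (fun x => max (-C) (min C (X x))) = ν := by
    rw [← hXm]; exact Measure.map_congr (clipmap X hX hXm)
  refine ⟨_, hXc, ?_, hXcm⟩
  have main : ∀ n : ℕ, ∀ ε : ℝ, 0 < ε → ε ≤ 1 →
      ρ (fun x => max (-C) (min C (X x))) ≤ 3 * ε + (C + C') / (n + 1) := by
    intro n ε hε hε1
    obtain ⟨ν₁, hν₁, h1, h2⟩ := h n ε hε hε1
    let κ : Measure (Fin (n+1)) := (PMF.uniformOfFintype (Fin (n+1))).toMeasure
    have hκ : ∀ j : Fin (n+1), κ {j}ᶜ = 1 - ((n + 1 : ℕ) : ℝ≥0∞)⁻¹ := by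
      intro j
      rw [prob_compl_eq_one_sub (measurableSet_singleton j), PMF.toMeasure_apply_singleton _ _
        (measurableSet_singleton j), PMF.uniformOfFintype_apply]
      simp
    obtain ⟨W, hW, hWm⟩ := exists_law P (ν.prod κ)
    have hZ0 : Measurable (fun ω => (W ω).1) := measurable_fst.comp hW
    have hZ0m : P.map (fun ω => (W ω).1) = ν := by
      have : (fun ω => (W ω).1) = Prod.fst ∘ W := rfl
      rw [this, ← Measure.map_map measurable_fst hW, hWm, Measure.map_fst_prod]; simp
    set Z : Ω → ℝ := fun ω => max (-C) (min C (W ω).1) with hZdef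
    have hZ : BddMeas Z := bdd_clip hZ0 hC
    have hZae := clipmap _ hZ0 hZ0m
    have hZm : P.map Z = ν := by rw [← hZ0m]; exact Measure.map_congr hZae
    have hZb : ∀ ω, |Z ω| ≤ C := fun ω =>
      abs_le.mpr ⟨le_max_left _ _, max_le (by linarith) (min_le_left _ _)⟩
    rw [hLI _ Z hXc hZ (hXcm.trans hZm.symm)]
    let V : ℕ → Ω → ℝ := fun j ω => if ((W ω).2 : ℕ) = j then -C' else Z ω - 3 * ε
    have hVm : ∀ j, Measurable (V j) := by
      intro j
      refine Measurable.ite ?_ measurable_const (hZ.1.sub_const _)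
      have : Measurable (fun ω => ((W ω).2 : ℕ)) :=
        (measurable_of_countable (fun i : Fin (n+1) => (i:ℕ))).comp (measurable_snd.comp hW)
      exact this (measurableSet_singleton j)
    have hVb : ∀ j ω, |V j ω| ≤ C + C' + 3 := by
      intro j ω
      have := abs_le.mp (hZb ω)
      simp only [V]
      split_ifs <;> rw [abs_le] <;> constructor <;> linarith [this.1, this.2]
    have hV0 : ∀ j, j < n + 1 → ρ (V j) ≤ 0 := by
      intro j hj
      have hVB : BddMeas (V j) := ⟨hVm j, _, hVb j⟩
      refine rho_of_law_mem hLI hVB ?_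
      have hpm := Measure.isProbabilityMeasure_map (μ := P) (hVm j).aemeasurable
      refine dom P hρ hLI hpm (C + C' + 3) ?_ hν₁ fun t => ?_
      · rw [Measure.map_apply (hVm j) measurableSet_Icc.compl]
        convert measure_empty (μ := P)
        ext ω
        simpa using abs_le.mp (hVb j ω)
      · rcases le_or_gt t (-C') with ht | ht
        · rw [h2 t ht]; exact prob_le_one
        · refine le_trans ?_ (h1 t)
          rw [Measure.map_apply (hVm j) measurableSet_Ici, ← hκ ⟨j, hj⟩, mul_comm,
            ← Measure.prod_prod, ← hWm,
            Measure.map_apply hW (measurableSet_Ici.prod (measurableSet_singleton _).compl)]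
          refine measure_mono_ae ?_
          filter_upwards [hZae] with ω hω hmem
          have hmem : t ≤ V j ω := hmem
          simp only [V] at hmem
          split_ifs at hmem with hif
          · linarith
          · refine ⟨?_, ?_⟩
            · change t + 3 * ε ≤ (W ω).1
              have : Z ω = (W ω).1 := hω
              linarith
            · intro hc
              apply hif
              have hc : (W ω).2 = ⟨j, hj⟩ := hc
              rw [hc]
    obtain ⟨ha, ha0⟩ := rho_avg hρ V _ hVm hVb n hV0
    have hle : ∀ ω, Z ω ≤ ((n:ℝ) + 1)⁻¹ * ∑ j ∈ Finset.range (n + 1), V j ω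
        + (3 * ε + (C + C') / (n + 1)) := by
      intro ω
      have hs : ∑ j ∈ Finset.range (n + 1), V j ω = (n + 1) * (Z ω - 3 * ε)
          + (-C' - (Z ω - 3 * ε)) := by
        have : ∀ j, V j ω = (Z ω - 3 * ε) +
            (if ((W ω).2 : ℕ) = j then (-C' - (Z ω - 3 * ε)) else 0) := by
          intro j
          simp only [V]; split_ifs <;> ring
        simp_rw [this]
        rw [Finset.sum_add_distrib, Finset.sum_ite_eq,
          if_pos (Finset.mem_range.mpr (W ω).2.2)]
        simp
        ring
      rw [hs]
      have hn : (0:ℝ) < (n:ℝ) + 1 := by positivity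
      have := abs_le.mp (hZb ω)
      have e : ((n:ℝ) + 1)⁻¹ * ((n + 1) * (Z ω - 3 * ε) + (-C' - (Z ω - 3 * ε)))
        + (3 * ε + (C + C') / (n + 1)) = Z ω + (C - Z ω + 3 * ε) / (n + 1) := by
        field_simp; ring
      rw [e]
      have : 0 ≤ (C - Z ω + 3 * ε) / (n + 1) := div_nonneg (by linarith [this.2]) hn.le
      linarith
    have hb2 : BddMeas (fun ω => ((n:ℝ) + 1)⁻¹ * ∑ j ∈ Finset.range (n + 1), V j ω
        + (3 * ε + (C + C') / (n + 1))) := by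
      obtain ⟨a1, K, a2⟩ := ha
      refine ⟨a1.add_const _, K + |3 * ε + (C + C') / (n + 1)|, fun ω => ?_⟩
      exact (abs_add_le _ _).trans (add_le_add (a2 ω) le_rfl)
    have h3 := hρ.mono _ _ hZ hb2 (ae_of_all _ hle)
    rw [hρ.cash _ _ ha] at h3
    linarith
  refine le_of_forall_pos_le_add fun η hη => ?_
  obtain ⟨n, hn⟩ := exists_nat_gt ((C + C') / (η / 2))
  have hη2 : 0 < η / 2 := by positivity
  have h4 : (C + C') / ((n:ℝ) + 1) ≤ η / 2 := by
    rw [div_lt_iff₀ hη2] at hn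
    rw [div_le_iff₀ (by positivity)]
    nlinarith
  have h5 := main n (min 1 (η / 6)) (by positivity) (min_le_left _ _)
  have h6 := min_le_right 1 (η / 6)
  linarith

lemma measurable_map_add {E : Type*} [MeasurableSpace E] {k : E → Measure ℝ} (hk : Measurable k)
    (hp : ∀ a, IsProbabilityMeasure (k a)) {f : E → ℝ} (hf : Measurable f) :
    Measurable (fun a => (k a).map (fun y => y + f a)) := by
  let κ : Kernel E ℝ := ⟨k, hk⟩
  have : IsMarkovKernel κ := ⟨hp⟩
  refine Measure.measurable_of_measurable_coe _ fun s hs => ?_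
  have h := Kernel.measurable_kernel_prodMk_left (κ := κ)
    (t := {q : E × ℝ | q.2 + f q.1 ∈ s}) ((by fun_prop : Measurable fun q : E × ℝ => q.2 + f q.1) hs)
  convert h using 2 with a
  rw [Measure.map_apply (by fun_prop) hs]
  rfl

lemma bind_Ici {E : Type*} [MeasurableSpace E] (γ : Measure E) {k : E → Measure ℝ}
    (hk : Measurable k)
    (hp : ∀ a, IsProbabilityMeasure (k a)) {f : E → ℝ} (hf : Measurable f) (t : ℝ) :
    γ.bind (fun a => (k a).map (fun y => y + f a)) (Set.Ici t) =
      ∫⁻ a, k a (Set.Ici (t - f a)) ∂γ := by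
  rw [Measure.bind_apply measurableSet_Ici (measurable_map_add hk hp hf).aemeasurable]
  refine lintegral_congr fun a => ?_
  rw [Measure.map_apply (by fun_prop) measurableSet_Ici]
  congr 1
  ext y
  simp

lemma exists_code {E : Type*} [MeasurableSpace E] {k : E → Measure ℝ} (hk : Measurable k)
    (hp : ∀ a, IsProbabilityMeasure (k a)) {M : ℝ} (hM : ∀ a, k a (Set.Icc (-M) M)ᶜ = 0)
    {ε : ℝ} (hε : 0 < ε) (n : ℕ) :
    ∃ c : E → ℕ, Measurable c ∧ ∀ a b, c a = c b → ∀ t,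
      (1 - ((n + 1 : ℕ) : ℝ≥0∞)⁻¹) * k a (Set.Ici t) ≤ k b (Set.Ici (t - ε)) := by
  let L : ℕ := ⌊(M + M) / ε⌋₊ + 1
  let g : E → ℕ → ℝ := fun a i => (k a (Set.Ici (-M + i * ε))).toReal
  let code : E → (Fin L → ℤ × ℤ) := fun a i =>
    (⌊Real.log (g a i) * (n + 1)⌋, ⌈g a i⌉)
  have hgm : ∀ i, Measurable fun a => g a i := fun i =>
    ((Measure.measurable_coe measurableSet_Ici).comp hk).ennreal_toReal
  have hcm : Measurable code := by
    refine measurable_pi_lambda _ fun i => Measurable.prodMk ?_ ?_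
    · exact Int.measurable_floor.comp ((Real.measurable_log.comp (hgm i)).mul_const _)
    · exact Int.measurable_ceil.comp (hgm i)
  refine ⟨fun a => Encodable.encode (code a), (measurable_of_countable _).comp hcm, ?_⟩
  intro a b hab t
  have hab : code a = code b := Encodable.encode_injective hab
  have hδ : (1 - ((n + 1 : ℕ) : ℝ≥0∞)⁻¹) ≤ 1 := tsub_le_self
  rcases lt_or_ge M t with ht | ht
  · have : k a (Set.Ici t) = 0 := by
      refine measure_mono_null ?_ (hM a)
      intro y hy hy'
      have : t ≤ y := hy
      linarith [hy'.2]
    rw [this]; simp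
  rcases lt_or_ge t (-M) with ht' | ht'
  · have : k b (Set.Ici (t - ε)) = 1 := by
      rw [← prob_compl_eq_zero_iff measurableSet_Ici]
      refine measure_mono_null (Set.compl_subset_compl.mpr ?_) (hM b)
      intro y hy
      have := hy.1
      change t - ε ≤ y
      linarith
    rw [this]
    exact mul_le_one' hδ prob_le_one
  let i : ℕ := ⌊(t + M) / ε⌋₊
  have hi0 : (0:ℝ) ≤ (t + M) / ε := div_nonneg (by linarith) hε.le
  have hiL : i < L := Nat.lt_succ_of_le (Nat.floor_mono (by gcongr))
  have hi1 : -M + i * ε ≤ t := by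
    have := Nat.floor_le hi0
    rw [le_div_iff₀ hε] at this
    linarith
  have hi2 : t - ε ≤ -M + i * ε := by
    have := (Nat.lt_floor_add_one ((t + M) / ε)).le
    rw [div_le_iff₀ hε] at this
    have e : ((⌊(t + M) / ε⌋₊ : ℝ) + 1) * ε = i * ε + ε := by ring
    linarith
  have hcode := congrFun hab ⟨i, hiL⟩
  have hc1 : ⌊Real.log (g a i) * (n + 1)⌋ = ⌊Real.log (g b i) * (n + 1)⌋ := congrArg Prod.fst hcode
  have hc2 : ⌈g a i⌉ = ⌈g b i⌉ := congrArg Prod.snd hcode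
  have hn : (0:ℝ) < n + 1 := by positivity
  have key : (1 - ((n:ℝ) + 1)⁻¹) * g a i ≤ g b i := by
    have ha0 : 0 ≤ g a i := ENNReal.toReal_nonneg
    have hb0 : 0 ≤ g b i := ENNReal.toReal_nonneg
    rcases ha0.eq_or_lt with h | h
    · rw [← h]; simpa using hb0
    have hb : 0 < g b i := by
      rw [← Int.ceil_pos, ← hc2, Int.ceil_pos]; exact h
    have h1 := Int.abs_sub_lt_one_of_floor_eq_floor hc1
    have h2 : Real.log (g a i) - (n+1:ℝ)⁻¹ ≤ Real.log (g b i) := by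
      have := (abs_lt.mp h1).2
      rw [← sub_mul] at this
      have : Real.log (g a i) - Real.log (g b i) ≤ (n+1:ℝ)⁻¹ := by
        rw [← one_div, le_div_iff₀ hn]; exact this.le
      linarith
    have h3 := Real.exp_le_exp.mpr h2
    rw [sub_eq_add_neg, Real.exp_add, Real.exp_log h, Real.exp_log hb] at h3
    have h4 := Real.add_one_le_exp (-(n+1:ℝ)⁻¹)
    nlinarith
  calc (1 - ((n + 1 : ℕ) : ℝ≥0∞)⁻¹) * k a (Set.Ici t)
      ≤ (1 - ((n + 1 : ℕ) : ℝ≥0∞)⁻¹) * k a (Set.Ici (-M + i * ε)) := by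
        gcongr
    _ ≤ k b (Set.Ici (-M + i * ε)) := by
        have e : (1 - ((n + 1 : ℕ) : ℝ≥0∞)⁻¹) = ENNReal.ofReal (1 - ((n:ℝ) + 1)⁻¹) := by
          rw [ENNReal.ofReal_sub _ (by positivity), ENNReal.ofReal_one,
            ENNReal.ofReal_inv_of_pos hn]
          congr 2
          rw [← Nat.cast_add_one, ENNReal.ofReal_natCast]
        have ea : k a (Set.Ici (-M + i * ε)) = ENNReal.ofReal (g a i) :=
          (ENNReal.ofReal_toReal (measure_ne_top _ _)).symm
        have eb : k b (Set.Ici (-M + i * ε)) = ENNReal.ofReal (g b i) :=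
          (ENNReal.ofReal_toReal (measure_ne_top _ _)).symm
        rw [e, ea, eb, ← ENNReal.ofReal_mul' ENNReal.toReal_nonneg]
        exact ENNReal.ofReal_le_ofReal key
    _ ≤ _ := by gcongr

lemma forward {Ω : Type*} [mΩ : MeasurableSpace Ω] [StandardBorelSpace Ω]
    (P : Measure Ω) [IsProbabilityMeasure P] [NullSingletonClass P]
    (ρ : (Ω → ℝ) → ℝ) (hρ : IsRiskMeasure P ρ) (hLI : LawInvariant P ρ)
    (hS : ShiftConvex (acceptanceSet P ρ)) (M : ℝ) (hM : 0 < M)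
    (γ : Measure (ℝ × {m : Measure ℝ // m ∈ acceptanceSet P ρ ∧ m (Set.Icc (-M) M)ᶜ = 0}))
    (hγ : IsProbabilityMeasure γ) (hγA : γ.map Prod.fst ∈ acceptanceSet P ρ) :
    γ.bind (fun p => ((p.2 : Measure ℝ)).map (fun y => y + p.1)) ∈ acceptanceSet P ρ := by
  let S := {m : Measure ℝ // m ∈ acceptanceSet P ρ ∧ m (Set.Icc (-M) M)ᶜ = 0}
  have hSp : ∀ m : S, IsProbabilityMeasure (m : Measure ℝ) := fun m => (mem_bdd P m.2.1).1
  have hk : Measurable (fun p : ℝ × S => (p.2 : Measure ℝ)) :=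
    measurable_subtype_coe.comp measurable_snd
  have hkp : ∀ p : ℝ × S, IsProbabilityMeasure (p.2 : Measure ℝ) := fun p => hSp p.2
  obtain ⟨-, B, hB0, hB⟩ := mem_bdd P hγA
  have hBae : ∀ᵐ p ∂γ, p.1 ∈ Set.Icc (-B) B :=
    ae_of_ae_map measurable_fst.aemeasurable (p := fun x => x ∈ Set.Icc (-B) B) hB
  have hTm := measurable_map_add hk hkp measurable_fst
  have hTp : ∀ p : ℝ × S, IsProbabilityMeasure ((p.2 : Measure ℝ).map (fun y => y + p.1)) :=
    fun p => Measure.isProbabilityMeasure_map (by fun_prop)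
  have hνp : IsProbabilityMeasure
      (γ.bind (fun p => ((p.2 : Measure ℝ)).map (fun y => y + p.1))) := by
    constructor
    rw [Measure.bind_apply MeasurableSet.univ hTm.aemeasurable]
    simp
  refine mem_of_approx P hρ hLI hνp (B + M) (B + M + 3) (by linarith) (by linarith) ?_ ?_
  · rw [Measure.bind_apply measurableSet_Icc.compl hTm.aemeasurable]
    refine (lintegral_congr_ae ?_).trans lintegral_zero
    filter_upwards [hBae] with p hp
    rw [Measure.map_apply (by fun_prop) measurableSet_Icc.compl]
    refine measure_mono_null ?_ p.2.2.2
    intro y hy hy'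
    refine hy ⟨?_, ?_⟩
    · linarith [hp.1, hy'.1]
    · linarith [hp.2, hy'.2]
  intro n ε hε hε1
  obtain ⟨c, hcm, hc⟩ := exists_code (E := S) measurable_subtype_coe hSp (fun m => m.2.2) hε n
  obtain ⟨p₀⟩ := nonempty_of_isProbabilityMeasure γ
  have hne : Nonempty S := ⟨p₀.2⟩
  let R : ℕ → S := Function.invFun c
  have hR : ∀ m, c (R (c m)) = c m := fun m => Function.invFun_eq ⟨m, rfl⟩
  let d : ℝ → ℕ := fun x => ⌊(Int.fract (x / ε))⁻¹⌋₊ - 2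
  have hdm : Measurable d := by
    refine (measurable_of_countable (fun j : ℕ => j - 2)).comp (Nat.measurable_floor.comp ?_)
    exact (measurable_fract.comp (measurable_id.div_const ε)).inv
  let x' : ℝ × S → ℝ := fun p => ε * (((⌊p.1 / ε⌋ - 1 : ℤ) : ℝ) + ((c p.2 : ℝ) + 2)⁻¹)
  have hfr : ∀ j : ℕ, 0 < ((j:ℝ) + 2)⁻¹ ∧ ((j:ℝ) + 2)⁻¹ < 1 := fun j =>
    ⟨by positivity, inv_lt_one_of_one_lt₀ (by linarith [(Nat.cast_nonneg j : (0:ℝ) ≤ j)])⟩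
  have hdx : ∀ p, d (x' p) = c p.2 := by
    intro p
    have h1 : x' p / ε = ((⌊p.1 / ε⌋ - 1 : ℤ) : ℝ) + ((c p.2 : ℝ) + 2)⁻¹ := by
      simp only [x']; field_simp
    have h2 : Int.fract (x' p / ε) = ((c p.2 : ℝ) + 2)⁻¹ := by
      rw [h1, Int.fract_intCast_add, Int.fract_eq_self]
      exact ⟨(hfr _).1.le, (hfr _).2⟩
    simp only [d]
    rw [h2, inv_inv]
    have : ((c p.2 : ℝ) + 2) = ((c p.2 + 2 : ℕ) : ℝ) := by push_cast; ring
    rw [this, Nat.floor_natCast]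
    omega
  have hx'm : Measurable x' := by
    have h1 : Measurable fun p : ℝ × S => ((⌊p.1 / ε⌋ - 1 : ℤ) : ℝ) :=
      (measurable_of_countable (fun z : ℤ => ((z - 1 : ℤ) : ℝ))).comp
        (Int.measurable_floor.comp (measurable_fst.div_const ε))
    have h2 : Measurable fun p : ℝ × S => ((c p.2 : ℝ) + 2)⁻¹ :=
      (measurable_of_countable (fun z : ℕ => ((z : ℝ) + 2)⁻¹)).comp (hcm.comp measurable_snd)
    exact (h1.add h2).const_mul ε
  have hx'le : ∀ p, x' p ≤ p.1 := by
    intro p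
    have h1 := Int.floor_le (p.1 / ε)
    rw [le_div_iff₀ hε] at h1
    have h2 := (hfr (c p.2)).2
    simp only [x']; push_cast
    nlinarith
  have hx'ge : ∀ p, p.1 - 2 * ε ≤ x' p := by
    intro p
    have h1 := (Int.lt_floor_add_one (p.1 / ε)).le
    rw [div_le_iff₀ hε] at h1
    have h2 := (hfr (c p.2)).1
    simp only [x']; push_cast
    nlinarith
  let K : ℝ → Measure ℝ := fun x => (R (d x) : Measure ℝ)
  have hKm : Measurable K :=
    (measurable_of_countable (fun j : ℕ => (R j : Measure ℝ))).comp hdm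
  have hKA : ∀ x, K x ∈ acceptanceSet P ρ ∧ (K x) (Set.Icc (-M) M)ᶜ = 0 := fun x => (R (d x)).2
  have hKp : ∀ x, IsProbabilityMeasure (K x) := fun x => hSp _
  have hμ' : γ.map x' ∈ acceptanceSet P ρ := by
    refine dom P hρ hLI (Measure.isProbabilityMeasure_map hx'm.aemeasurable) (B + 2) ?_ hγA ?_
    · rw [Measure.map_apply hx'm measurableSet_Icc.compl]
      have : ∀ᵐ p ∂γ, x' p ∈ Set.Icc (-(B + 2)) (B + 2) := by
        filter_upwards [hBae] with p hp
        exact ⟨by linarith [hx'ge p, hp.1], by linarith [hx'le p, hp.2]⟩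
      exact this
    · intro t
      rw [Measure.map_apply hx'm measurableSet_Ici,
        Measure.map_apply measurable_fst measurableSet_Ici]
      refine measure_mono fun p hp => ?_
      exact le_trans (show t ≤ x' p from hp) (hx'le p)
  have hν₁ := hS _ hμ' M hM K hKm hKA
  have hKI : ∀ t, (γ.map x').bind (fun x => (K x).map (fun y => y + x)) (Set.Ici t) =
      ∫⁻ p, (R (c p.2) : Measure ℝ) (Set.Ici (t - x' p)) ∂γ := by
    intro t
    have hmm := measurable_map_add hKm hKp measurable_id
    simp only [id] at hmm
    rw [Measure.bind_apply measurableSet_Ici hmm.aemeasurable]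
    refine (lintegral_map ((Measure.measurable_coe measurableSet_Ici).comp hmm) hx'm).trans ?_
    simp only [Function.comp]
    refine lintegral_congr fun p => ?_
    simp only [K]
    rw [hdx, Measure.map_apply (by fun_prop) measurableSet_Ici]
    congr 1
    ext y
    simp
  refine ⟨_, hν₁, fun t => ?_, fun t ht => ?_⟩
  · rw [hKI, bind_Ici γ hk hkp measurable_fst, ← lintegral_const_mul']
    · refine lintegral_mono fun p => ?_
      calc _ ≤ (1 - ((n + 1 : ℕ) : ℝ≥0∞)⁻¹) * (p.2 : Measure ℝ) (Set.Ici (t - x' p + ε)) := by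
            gcongr
            linarith [hx'ge p]
        _ ≤ (R (c p.2) : Measure ℝ) (Set.Ici (t - x' p + ε - ε)) := hc _ _ (hR p.2).symm _
        _ = _ := by rw [add_sub_cancel_right]
    · exact (tsub_le_self.trans_lt ENNReal.one_lt_top).ne
  · rw [hKI]
    have : ∀ᵐ p ∂γ, (R (c p.2) : Measure ℝ) (Set.Ici (t - x' p)) = 1 := by
      filter_upwards [hBae] with p hp
      have := hSp (R (c p.2))
      rw [← prob_compl_eq_zero_iff measurableSet_Ici]
      refine measure_mono_null (Set.compl_subset_compl.mpr ?_) (R (c p.2)).2.2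
      intro y hy
      change t - x' p ≤ y
      linarith [hy.1, hx'ge p, hp.1]
    rw [lintegral_congr_ae this]
    simp

lemma backward {Ω : Type*} [mΩ : MeasurableSpace Ω]
    (P : Measure Ω) [IsProbabilityMeasure P] (ρ : (Ω → ℝ) → ℝ)
    (h : ∀ M : ℝ, 0 < M →
        ∀ γ : Measure (ℝ ×
          {m : Measure ℝ // m ∈ acceptanceSet P ρ ∧ m (Set.Icc (-M) M)ᶜ = 0}),
          IsProbabilityMeasure γ → γ.map Prod.fst ∈ acceptanceSet P ρ →
          γ.bind (fun p => ((p.2 : Measure ℝ)).map (fun y => y + p.1)) ∈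
            acceptanceSet P ρ) : ShiftConvex (acceptanceSet P ρ) := by
  intro μ hμ M hM K hK hKA
  have hμp := (mem_bdd P hμ).1
  let F : ℝ → ℝ × {m : Measure ℝ // m ∈ acceptanceSet P ρ ∧ m (Set.Icc (-M) M)ᶜ = 0} :=
    fun x => (x, ⟨K x, hKA x⟩)
  have hF : Measurable F := measurable_id.prodMk hK.subtype_mk
  have h1 : (μ.map F).map Prod.fst = μ := by
    rw [Measure.map_map measurable_fst hF]
    exact Measure.map_id
  have h2 := h M hM (μ.map F) (Measure.isProbabilityMeasure_map hF.aemeasurable) (by rwa [h1])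
  have hTm := measurable_map_add
    (E := ℝ × {m : Measure ℝ // m ∈ acceptanceSet P ρ ∧ m (Set.Icc (-M) M)ᶜ = 0})
    (k := fun p => (p.2 : Measure ℝ)) (measurable_subtype_coe.comp measurable_snd)
    (fun p => (mem_bdd P p.2.2.1).1) measurable_fst
  have hKm := measurable_map_add hK (fun x => (mem_bdd P (hKA x).1).1) measurable_id
  simp only [id] at hKm
  convert h2 using 1
  refine Measure.ext fun s hs => ?_
  rw [Measure.bind_apply hs hKm.aemeasurable, Measure.bind_apply hs hTm.aemeasurable]
  exact (lintegral_map ((Measure.measurable_coe hs).comp hTm) hF).symm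

/-- The measure acceptance set `𝓐` of a law invariant risk measure is
shift-convex if and only if it satisfies property (S): for each `M > 0` and each Borel
probability measure `γ` on `ℝ × (𝓐 ∩ 𝓟[-M,M])` whose first marginal belongs to `𝓐`, the
measure `∫ γ(dx,dm) m(· − x)` belongs to `𝓐`. -/
theorem statement14 {Ω : Type*} [mΩ : MeasurableSpace Ω] [StandardBorelSpace Ω]
    (P : Measure Ω) [IsProbabilityMeasure P] [NullSingletonClass P]
    (ρ : (Ω → ℝ) → ℝ) (hρ : IsRiskMeasure P ρ) (hLI : LawInvariant P ρ) :
    ShiftConvex (acceptanceSet P ρ) ↔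
      (∀ M : ℝ, 0 < M →
        ∀ γ : Measure (ℝ ×
          {m : Measure ℝ // m ∈ acceptanceSet P ρ ∧ m (Set.Icc (-M) M)ᶜ = 0}),
          IsProbabilityMeasure γ → γ.map Prod.fst ∈ acceptanceSet P ρ →
          γ.bind (fun p => ((p.2 : Measure ℝ)).map (fun y => y + p.1)) ∈
            acceptanceSet P ρ) := by
  exact ⟨fun h M hM γ hγ hA => forward P ρ hρ hLI h M hM γ hγ hA, fun h => backward P ρ h⟩

end RiskDiv
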